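/- Let V be a finite-dimensional complex vector space and let g_1, …, g_m be pairwise commuting linear automorphisms of V, each of finite order. Then the rational number Obs(g_1, …, g_m) := Σ_{i=1}^m age(g_i) + age((g_1 ⋯ g_m)⁻¹) − (dim_ℂ V − dim_ℂ Fix(g_1, …, g_m)) is a nonnegative integer. -/

import Mathlib

open Complex

/-- The `w`-eigenspace of a linear automorphism `g`, i.e. the kernel of
`g - e^{2πi w}·id`, where the weight `w` is a rational number. -/
noncomputable def eigenKer {V : Type*} [AddCommGroup V] [Module ℂ V]
    (g : V ≃ₗ[ℂ] V) (w : ℚ) : Submodule ℂ V :=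
  LinearMap.ker ((g : V →ₗ[ℂ] V) -
    Complex.exp (2 * Real.pi * Complex.I * (w : ℂ)) • (LinearMap.id : V →ₗ[ℂ] V))

/-- The age (degree shifting number) of a finite order automorphism `g` of order `r`:
`age g = Σ_{j=0}^{r-1} (j/r) · dim_ℂ ker(g - e^{2πij/r}·id)`. -/
noncomputable def age {V : Type*} [AddCommGroup V] [Module ℂ V]
    (g : V ≃ₗ[ℂ] V) : ℚ :=
  ∑ j ∈ Finset.range (orderOf g),
    ((j : ℚ) / (orderOf g : ℚ)) *
      (Module.finrank ℂ (eigenKer g ((j : ℚ) / (orderOf g : ℚ))) : ℚ)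

/-- The common fixed subspace `Fix(g_1, …, g_m) = ⋂ᵢ ker(gᵢ - id)` of a tuple of
linear automorphisms. -/
noncomputable def fixedSpace {V : Type*} [AddCommGroup V] [Module ℂ V]
    {m : ℕ} (g : Fin m → (V ≃ₗ[ℂ] V)) : Submodule ℂ V :=
  ⨅ i, LinearMap.ker ((g i : V →ₗ[ℂ] V) - (LinearMap.id : V →ₗ[ℂ] V))

/-- `codim(g_1, …, g_m) = dim_ℂ V - dim_ℂ Fix(g_1, …, g_m)`. -/
noncomputable def codim {V : Type*} [AddCommGroup V] [Module ℂ V]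
    {m : ℕ} (g : Fin m → (V ≃ₗ[ℂ] V)) : ℚ :=
  (Module.finrank ℂ V : ℚ) - (Module.finrank ℂ (fixedSpace g) : ℚ)

/-- `Obs(g_1, …, g_m) = Σᵢ age(gᵢ) + age((g_1⋯g_m)⁻¹) - codim(g_1, …, g_m)`. -/
noncomputable def Obs {V : Type*} [AddCommGroup V] [Module ℂ V]
    {m : ℕ} (g : Fin m → (V ≃ₗ[ℂ] V)) : ℚ :=
  (∑ i, age (g i)) + age ((List.ofFn g).prod)⁻¹ - codim g

open Module

section RationalExp

lemma exp_two_pi_mul_I_mul_ratCast_eq_one_iff (w : ℚ) :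
    Complex.exp (2 * Real.pi * Complex.I * (w : ℂ)) = 1 ↔ ∃ n : ℤ, w = n := by
  rw [Complex.exp_eq_one_iff]
  refine exists_congr fun n => ?_
  rw [mul_comm, mul_left_inj' Complex.two_pi_I_ne_zero]
  norm_cast

lemma eq_of_exp_two_pi_mul_I_mul_ratCast_eq {a b : ℚ} (ha : a ∈ Set.Ico 0 1)
    (hb : b ∈ Set.Ico 0 1)
    (h : Complex.exp (2 * Real.pi * Complex.I * (a : ℂ)) =
      Complex.exp (2 * Real.pi * Complex.I * (b : ℂ))) : a = b := by
  have h1 : Complex.exp (2 * Real.pi * Complex.I * ((a - b : ℚ) : ℂ)) = 1 := by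
    push_cast
    rw [mul_sub, Complex.exp_sub, h, div_self (Complex.exp_ne_zero _)]
  obtain ⟨n, hn⟩ := (exp_two_pi_mul_I_mul_ratCast_eq_one_iff _).1 h1
  obtain ⟨ha0, ha1⟩ := ha
  obtain ⟨hb0, hb1⟩ := hb
  have h2 : (n : ℚ) < 1 := by linarith
  have h3 : (-1 : ℚ) < n := by linarith
  have h4 : n < 1 := by exact_mod_cast h2
  have h5 : -1 < n := by exact_mod_cast h3
  obtain rfl : n = 0 := by omega
  simpa [sub_eq_zero] using hn

lemma exp_two_pi_mul_I_mul_fract (w : ℚ) :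
    Complex.exp (2 * Real.pi * Complex.I * ((Int.fract w : ℚ) : ℂ)) =
      Complex.exp (2 * Real.pi * Complex.I * (w : ℂ)) := by
  rw [← Int.self_sub_floor]
  push_cast
  rw [mul_sub, Complex.exp_sub, mul_comm _ (⌊w⌋ : ℂ), Complex.exp_int_mul_two_pi_mul_I, div_one]

lemma exists_exp_two_pi_mul_I_mul_ratCast_eq {z : ℂ} {n : ℕ} (hn : 0 < n) (hz : z ^ n = 1) :
    ∃ w : ℚ, w ∈ Set.Ico 0 1 ∧ Complex.exp (2 * Real.pi * Complex.I * (w : ℂ)) = z := by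
  have : NeZero n := ⟨hn.ne'⟩
  obtain ⟨i, hi, h⟩ := (Complex.isPrimitiveRoot_exp n hn.ne').eq_pow_of_pow_eq_one hz
  refine ⟨i / n, ⟨by positivity, ?_⟩, ?_⟩
  · rw [div_lt_one (by exact_mod_cast hn)]
    exact_mod_cast hi
  · rw [← h, ← Complex.exp_nat_mul]
    push_cast
    congr 1
    ring

end RationalExp

section Basis

variable {K V ι : Type*} [Field K] [AddCommGroup V] [Module K V]

lemma Module.Basis.finrank_eq_card_of_mem_iff [Fintype ι] (b : Basis ι K V) (W : Submodule K V)
    (p : ι → Prop) [DecidablePred p] (h : ∀ v, v ∈ W ↔ ∀ k, ¬ p k → b.repr v k = 0) :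
    finrank K W = (Finset.univ.filter p).card := by
  have hW : W = Submodule.span K (Set.range fun k : {k // p k} => b k) := by
    have : (Set.range fun k : {k // p k} => b k) = b '' {k | p k} := by
      ext; simp
    ext v
    rw [this, b.mem_span_image, h]
    refine forall_congr' fun k => ?_
    simp only [SetLike.mem_coe, Finsupp.mem_support_iff, Set.mem_ofPred_eq]
    exact not_imp_comm
  rw [hW, ← Fintype.card_subtype]
  exact finrank_span_eq_card (b.linearIndependent.comp _ Subtype.val_injective)

lemma Module.Basis.repr_apply_of_apply_eq_smul (b : Basis ι K V) {f : V →ₗ[K] V} {c : ι → K}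
    (h : ∀ k, f (b k) = c k • b k) (v : V) (k : ι) : b.repr (f v) k = c k * b.repr v k := by
  have : b.coord k ∘ₗ f = c k • b.coord k := by
    refine b.ext fun j => ?_
    classical
    by_cases hj : j = k <;> simp [h, hj]
  simpa using LinearMap.congr_fun this v

lemma Module.Basis.mem_ker_sub_smul_id_iff (b : Basis ι K V) {f : V →ₗ[K] V} {c : ι → K}
    (h : ∀ k, f (b k) = c k • b k) (μ : K) (v : V) :
    v ∈ LinearMap.ker (f - μ • (LinearMap.id : V →ₗ[K] V)) ↔
      ∀ k, ¬ c k = μ → b.repr v k = 0 := by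
  rw [LinearMap.mem_ker, ← b.repr.map_eq_zero_iff, Finsupp.ext_iff]
  refine forall_congr' fun k => ?_
  simp only [LinearMap.sub_apply, LinearMap.smul_apply, LinearMap.id_apply, map_sub, map_smul,
    Finsupp.sub_apply, Finsupp.smul_apply, b.repr_apply_of_apply_eq_smul h, smul_eq_mul,
    Finsupp.zero_apply, ← sub_mul, mul_eq_zero, sub_eq_zero]
  exact or_iff_not_imp_left

end Basis

section FiniteOrder

variable {V : Type*} [AddCommGroup V] [Module ℂ V]

lemma pow_apply_eq_smul {g : V ≃ₗ[ℂ] V} {c : ℂ} {v : V} (h : g v = c • v) (n : ℕ) :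
    (g ^ n) v = c ^ n • v := by
  induction n with
  | zero => simp
  | succ n ih => rw [pow_succ', LinearEquiv.mul_apply, ih, map_smul, h, smul_smul, pow_succ]

lemma pow_orderOf_eq_one_of_apply_eq_smul {g : V ≃ₗ[ℂ] V} {c : ℂ} {v : V} (hv : v ≠ 0)
    (h : g v = c • v) : c ^ orderOf g = 1 := by
  have h1 := pow_apply_eq_smul h (orderOf g)
  rw [pow_orderOf_eq_one, LinearEquiv.coe_one, id] at h1
  exact smul_left_injective ℂ hv (by simpa using h1.symm)

lemma list_ofFn_prod_apply {m : ℕ} {g : Fin m → (V ≃ₗ[ℂ] V)} {c : Fin m → ℂ} {v : V}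
    (h : ∀ i, g i v = c i • v) : (List.ofFn g).prod v = (∏ i, c i) • v := by
  induction m with
  | zero => simp
  | succ m ih =>
    rw [List.ofFn_succ, List.prod_cons, LinearEquiv.mul_apply, ih fun i => h i.succ, map_smul, h,
      smul_smul, Fin.prod_univ_succ, mul_comm]

lemma isOfFinOrder_list_ofFn_prod {G : Type*} [Monoid G] {m : ℕ} {g : Fin m → G}
    (hcomm : ∀ i j, Commute (g i) (g j)) (hfin : ∀ i, IsOfFinOrder (g i)) :
    IsOfFinOrder (List.ofFn g).prod := by
  induction m with
  | zero => simp
  | succ m ih =>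
    rw [List.ofFn_succ, List.prod_cons]
    refine Commute.isOfFinOrder_mul (Commute.list_prod_right _ _ ?_) (hfin 0)
      (ih (fun i j => hcomm _ _) fun i => hfin _)
    simp only [List.mem_ofFn]
    rintro _ ⟨i, rfl⟩
    exact hcomm _ _

/-- The age of a finite order automorphism is the sum of its weights in an eigenbasis. -/
lemma age_eq_sum_of_basis {ι : Type*} [Fintype ι] (b : Basis ι ℂ V) {g : V ≃ₗ[ℂ] V}
    (hg : IsOfFinOrder g) {w : ι → ℚ} (hw : ∀ k, w k ∈ Set.Ico 0 1)
    (h : ∀ k, g (b k) = Complex.exp (2 * Real.pi * Complex.I * (w k : ℂ)) • b k) :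
    age g = ∑ k, w k := by
  classical
  have hr : (0 : ℚ) < orderOf g := by exact_mod_cast hg.orderOf_pos
  have hIco : ∀ j ∈ Finset.range (orderOf g), (j : ℚ) / orderOf g ∈ Set.Ico (0 : ℚ) 1 := by
    intro j hj
    refine ⟨by positivity, ?_⟩
    rw [div_lt_one hr]
    exact_mod_cast Finset.mem_range.1 hj
  have hdim : ∀ j ∈ Finset.range (orderOf g),
      finrank ℂ (eigenKer g ((j : ℚ) / orderOf g)) =
        (Finset.univ.filter fun k => w k = (j : ℚ) / orderOf g).card := by
    intro j hj
    refine b.finrank_eq_card_of_mem_iff _ _ fun v => ?_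
    rw [eigenKer, b.mem_ker_sub_smul_id_iff (f := (g : V →ₗ[ℂ] V)) h]
    refine forall_congr' fun k => imp_congr_left (not_congr ⟨?_, fun e => by rw [e]⟩)
    exact eq_of_exp_two_pi_mul_I_mul_ratCast_eq (hw k) (hIco j hj)
  have hex : ∀ k, ∃ j ∈ Finset.range (orderOf g), (j : ℚ) / orderOf g = w k := by
    intro k
    have h1 := pow_orderOf_eq_one_of_apply_eq_smul (b.ne_zero k) (h k)
    rw [← Complex.exp_nat_mul] at h1
    have h2 : Complex.exp (2 * Real.pi * Complex.I * ((orderOf g * w k : ℚ) : ℂ)) = 1 := by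
      rw [← h1]
      push_cast
      congr 1
      ring
    obtain ⟨n, hn⟩ := (exp_two_pi_mul_I_mul_ratCast_eq_one_iff _).1 h2
    have hn0 : 0 ≤ n := by
      have : (0 : ℚ) ≤ n := hn ▸ mul_nonneg hr.le (hw k).1
      exact_mod_cast this
    lift n to ℕ using hn0
    refine ⟨n, Finset.mem_range.2 ?_, ?_⟩
    · have : (n : ℚ) < orderOf g := by
        have := mul_lt_mul_of_pos_left (hw k).2 hr
        rw [hn] at this
        simpa using this
      exact_mod_cast this
    · rw [div_eq_iff hr.ne', mul_comm, hn]
      simp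
  calc age g = ∑ j ∈ Finset.range (orderOf g), ∑ k,
          if w k = (j : ℚ) / orderOf g then w k else 0 := by
        refine Finset.sum_congr rfl fun j hj => ?_
        rw [hdim j hj, ← Finset.sum_filter, mul_comm, ← nsmul_eq_mul]
        refine (Finset.sum_eq_card_nsmul fun k hk => ?_).symm
        exact (Finset.mem_filter.1 hk).2
    _ = ∑ k, w k := by
        rw [Finset.sum_comm]
        refine Finset.sum_congr rfl fun k _ => ?_
        obtain ⟨j, hj, hjk⟩ := hex k
        rw [Finset.sum_eq_single_of_mem j hj, if_pos hjk.symm]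
        intro i _ hij
        refine if_neg fun e => hij ?_
        rw [← hjk, div_left_inj' hr.ne'] at e
        exact_mod_cast e.symm

lemma finrank_fixedSpace_eq_card {ι : Type*} [Fintype ι] (b : Basis ι ℂ V) {m : ℕ}
    {g : Fin m → (V ≃ₗ[ℂ] V)} {c : Fin m → ι → ℂ} (h : ∀ i k, g i (b k) = c i k • b k)
    [DecidablePred fun k => ∀ i, c i k = 1] :
    finrank ℂ (fixedSpace g) = (Finset.univ.filter fun k => ∀ i, c i k = 1).card := by
  refine b.finrank_eq_card_of_mem_iff _ _ fun v => ?_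
  have hmem i : v ∈ LinearMap.ker ((g i : V →ₗ[ℂ] V) - (LinearMap.id : V →ₗ[ℂ] V)) ↔
      ∀ k, ¬ c i k = 1 → b.repr v k = 0 := by
    simpa using b.mem_ker_sub_smul_id_iff (f := (g i : V →ₗ[ℂ] V)) (h i) 1 v
  simp only [fixedSpace, Submodule.mem_iInf, hmem, not_forall, forall_exists_index]
  exact forall_comm

lemma isSemisimple_of_isOfFinOrder [FiniteDimensional ℂ V] {g : V ≃ₗ[ℂ] V}
    (hg : IsOfFinOrder g) : End.IsSemisimple (g : End ℂ V) := by
  have hr : (orderOf g : ℂ) ≠ 0 := by exact_mod_cast hg.orderOf_pos.ne'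
  refine End.isSemisimple_of_squarefree_aeval_eq_zero
    (Polynomial.X_pow_sub_one_separable_iff.2 hr).squarefree ?_
  have h : (g : End ℂ V) ^ orderOf g = 1 := by
    have := congrArg (LinearEquiv.automorphismGroup.toLinearMapMonoidHom (R := ℂ) (M := V))
      (pow_orderOf_eq_one g)
    rwa [map_pow, map_one] at this
  simp [h]

lemma exists_basis_forall_apply_eq_smul [FiniteDimensional ℂ V] {α : Type*}
    (g : α → (V ≃ₗ[ℂ] V)) (hcomm : ∀ i j, Commute (g i) (g j))
    (hfin : ∀ i, IsOfFinOrder (g i)) :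
    ∃ (n : ℕ) (b : Basis (Fin n) ℂ V) (c : α → Fin n → ℂ), ∀ i k, g i (b k) = c i k • b k := by
  classical
  let f : α → End ℂ V := fun i => g i
  have hf : ∀ i j, Commute (f i) (f j) := fun i j =>
    (hcomm i j).map (LinearEquiv.automorphismGroup.toLinearMapMonoidHom (R := ℂ) (M := V))
  have hint := DirectSum.isInternal_submodule_of_iSupIndep_of_iSup_eq_top
    (End.independent_iInf_maxGenEigenspace_of_forall_mapsTo f fun i j =>
      End.mapsTo_maxGenEigenspace_of_comm (hf j i))
    (End.iSup_iInf_maxGenEigenspace_eq_top_of_iSup_maxGenEigenspace_eq_top_of_commute f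
      (fun i j _ => hf i j) fun i => End.iSup_maxGenEigenspace_eq_top (f i))
  let b := hint.collectedBasis fun χ => finBasis ℂ
    (⨅ i, (f i).maxGenEigenspace (χ i) : Submodule ℂ V)
  let := FiniteDimensional.fintypeBasisIndex b
  let e := Fintype.equivFin ((χ : α → ℂ) × Fin (finrank ℂ
    (⨅ i, (f i).maxGenEigenspace (χ i) : Submodule ℂ V)))
  refine ⟨_, b.reindex e, fun i k => (e.symm k).1 i, fun i k => ?_⟩
  have hmem := (Submodule.mem_iInf _).1 (hint.collectedBasis_mem
    (fun χ => finBasis ℂ (⨅ i, (f i).maxGenEigenspace (χ i) : Submodule ℂ V)) (e.symm k)) i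
  rw [(isSemisimple_of_isOfFinOrder (hfin i)).isFinitelySemisimple.maxGenEigenspace_eq_eigenspace,
    End.mem_eigenspace_iff] at hmem
  rw [b.reindex_apply]
  exact hmem

end FiniteOrder

/-- For weights in `[0, 1)`, the contribution of a common eigenline to the obstruction rank. -/
lemma exists_nat_sum_add_fract_neg_sum {α : Type*} [Fintype α] {w : α → ℚ} (hw : ∀ i, 0 ≤ w i)
    [Decidable (∀ i, w i = 0)] :
    ∃ n : ℕ, ∑ i, w i + Int.fract (-∑ i, w i) - (1 - if ∀ i, w i = 0 then 1 else 0) = n := by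
  split_ifs with h
  · exact ⟨0, by simp [h]⟩
  · have hpos : 0 < ∑ i, w i := by
      push Not at h
      obtain ⟨i, hi⟩ := h
      exact Finset.sum_pos' (fun i _ => hw i) ⟨i, Finset.mem_univ i, (hw i).lt_of_ne' hi⟩
    have hceil : 0 < ⌈∑ i, w i⌉ := Int.ceil_pos.2 hpos
    refine ⟨(⌈∑ i, w i⌉ - 1).toNat, ?_⟩
    have hcast : (((⌈∑ i, w i⌉ - 1).toNat : ℤ) : ℚ) = ((⌈∑ i, w i⌉ - 1 : ℤ) : ℚ) := by
      rw [Int.toNat_of_nonneg (by omega)]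
    rw [← Int.self_sub_floor, Int.floor_neg]
    push_cast at hcast ⊢
    rw [hcast]
    ring

theorem Obs_eq_nonneg_int {V : Type*} [AddCommGroup V] [Module ℂ V]
    [FiniteDimensional ℂ V] {m : ℕ} (g : Fin m → (V ≃ₗ[ℂ] V))
    (hcomm : ∀ i j, Commute (g i) (g j)) (hfin : ∀ i, IsOfFinOrder (g i)) :
    ∃ n : ℕ, Obs g = (n : ℚ) := by
  classical
  obtain ⟨d, b, c, hc⟩ := exists_basis_forall_apply_eq_smul g hcomm hfin
  choose w hw hwc using fun i k => exists_exp_two_pi_mul_I_mul_ratCast_eq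
    (hfin i).orderOf_pos (pow_orderOf_eq_one_of_apply_eq_smul (b.ne_zero k) (hc i k))
  have hage i : age (g i) = ∑ k, w i k :=
    age_eq_sum_of_basis b (hfin i) (hw i) fun k => by rw [hwc, hc]
  have hprod k : (List.ofFn g).prod (b k) =
      Complex.exp (2 * Real.pi * Complex.I * ((∑ i, w i k : ℚ) : ℂ)) • b k := by
    rw [list_ofFn_prod_apply fun i => hc i k]
    push_cast
    rw [Finset.mul_sum, Complex.exp_sum]
    simp_rw [hwc]
  have hinv : age ((List.ofFn g).prod)⁻¹ = ∑ k, Int.fract (-∑ i, w i k) := by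
    refine age_eq_sum_of_basis b (isOfFinOrder_list_ofFn_prod hcomm hfin).inv
      (fun k => ⟨Int.fract_nonneg _, Int.fract_lt_one _⟩) fun k => ?_
    rw [exp_two_pi_mul_I_mul_fract]
    apply (List.ofFn g).prod.injective
    rw [map_smul, hprod, smul_smul, ← Complex.exp_add, ← LinearEquiv.mul_apply, mul_inv_cancel]
    simp
  have hone i k : c i k = 1 ↔ w i k = 0 := by
    rw [← hwc]
    refine ⟨fun h => eq_of_exp_two_pi_mul_I_mul_ratCast_eq (hw i k) (by simp) (by simpa using h),
      fun h => by simp [h]⟩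
  have hcodim : codim g = ∑ k, (1 - if ∀ i, w i k = 0 then 1 else 0 : ℚ) := by
    rw [codim, finrank_fixedSpace_eq_card b hc, finrank_eq_card_basis b]
    simp [hone]
  choose n hn using fun k => exists_nat_sum_add_fract_neg_sum fun i => (hw i k).1
  refine ⟨∑ k, n k, ?_⟩
  rw [Obs, hinv, hcodim, Finset.sum_congr rfl fun i _ => hage i, Finset.sum_comm,
    ← Finset.sum_add_distrib, ← Finset.sum_sub_distrib, Nat.cast_sum]
  exact Finset.sum_congr rfl fun k _ => hn k
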